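/- Let a, b be complex numbers with Re(a) < 1 and Re(b) < 1, and suppose a + b is not equal to any integer n with n ≤ 1. Then for every nonnegative integer N, as t ↓ 0, h_{a,b}(t) − c(a,b) t^{(1-a-b)/2} − Σ_{n=0}^{N} c_n(a,b) t^{n/2} = O(t^{(N+1)/2}). -/

import Mathlib

open MeasureTheory

/-- The heat content of `[0,1]` in `ℝ` with initial temperature `x^{-a}` and
specific heat `y^{-b}`, for complex `a`, `b`. -/
noncomputable def heatContentI (a b : ℂ) (t : ℝ) : ℂ :=
  (↑(Real.sqrt (4 * Real.pi * t)) : ℂ)⁻¹ *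
    ∫ x in (0:ℝ)..1, ∫ y in (0:ℝ)..1,
      (↑(Real.exp (-(x - y) ^ 2 / (4 * t))) : ℂ) * (x : ℂ) ^ (-a) * (y : ℂ) ^ (-b)

/-- The ascending factorial `θ_n(a) = a(a+1)⋯(a+n-1)`, with `θ_0(a) = 1`. -/
noncomputable def thetaAsc (a : ℂ) (n : ℕ) : ℂ :=
  ∏ i ∈ Finset.range n, (a + i)

/-- The coefficient `c(a,b)` of `t^{(1-a-b)/2}` in the heat content expansion. -/
noncomputable def cCoeff (a b : ℂ) : ℂ :=
  (2 : ℂ) ^ (-a - b) * (↑(Real.sqrt Real.pi) : ℂ)⁻¹ *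
    Complex.Gamma ((2 - a - b) / 2) * Complex.Gamma (a + b - 1) *
    (Complex.Gamma (1 - a) / Complex.Gamma b + Complex.Gamma (1 - b) / Complex.Gamma a)

/-- The coefficient `c_n(a,b)` of `t^{n/2}` in the heat content expansion. -/
noncomputable def cnCoeff (a b : ℂ) (n : ℕ) : ℂ :=
  (thetaAsc a n + thetaAsc b n) * (2 : ℂ) ^ ((n : ℤ) - 1) *
      Complex.Gamma ((1 + (n : ℂ)) / 2) /
    ((↑(Real.sqrt Real.pi) : ℂ) * (1 - a - b - (n : ℂ)) * (n.factorial : ℂ))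

open Complex (Gamma)
open Set Filter Topology Asymptotics

/-- The Taylor remainder of order `L` of `v ↦ (1 - v) ^ (-a)` at `0`. -/
noncomputable def taylorRem (a : ℂ) (L : ℕ) (v : ℝ) : ℂ :=
  (1 - (v : ℂ)) ^ (-a) - ∑ n ∈ Finset.range L, thetaAsc a n / (n.factorial : ℂ) * (v : ℂ) ^ n

lemma thetaAsc_eq_eval (a : ℂ) (n : ℕ) : thetaAsc a n = (ascPochhammer ℂ n).eval a := by
  induction n with
  | zero => simp [thetaAsc]
  | succ n ih =>
    rw [thetaAsc, Finset.prod_range_succ, ← thetaAsc, ih, ascPochhammer_succ_eval]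

lemma choose_eq_thetaAsc_div (a : ℂ) (n : ℕ) :
    Ring.choose (a + n - 1) n = thetaAsc a n / (n.factorial : ℂ) := by
  rw [← Ring.multichoose_eq, eq_div_iff (by exact_mod_cast n.factorial_ne_zero), thetaAsc_eq_eval,
    mul_comm, ← nsmul_eq_mul, Ring.factorial_nsmul_multichoose_eq_ascPochhammer,
    Polynomial.ascPochhammer_smeval_eq_eval]

lemma taylorRem_isBigO (a : ℂ) (L : ℕ) :
    taylorRem a L =O[𝓝[>] 0] fun v : ℝ => v ^ L := by
  have h := (Complex.one_div_one_sub_cpow_hasFPowerSeriesOnBall_zero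
    a).hasFPowerSeriesAt.isBigO_sub_partialSum_pow L
  have hc : Tendsto (fun v : ℝ => (v : ℂ)) (𝓝[>] 0) (𝓝 0) :=
    (Complex.continuous_ofReal.tendsto' 0 0 (by simp)).mono_left nhdsWithin_le_nhds
  refine ((h.comp_tendsto hc).congr' (.of_forall fun v => ?_) ?_)
  · simp only [Function.comp_apply, zero_add, taylorRem, Complex.cpow_neg, one_div,
      FormalMultilinearSeries.partialSum, FormalMultilinearSeries.ofScalars_apply_eq,
      smul_eq_mul, choose_eq_thetaAsc_div]
  · filter_upwards [self_mem_nhdsWithin] with v hv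
    simp [abs_of_pos (show (0 : ℝ) < v from hv)]

lemma exp_neg_sq_le_mul_inv_pow (M : ℕ) {y : ℝ} (hy : 0 < y) :
    Real.exp (-y ^ 2) ≤ (1 + M.factorial) * (y ^ M)⁻¹ := by
  have hM : (0 : ℝ) < M.factorial := by exact_mod_cast M.factorial_pos
  have h1 : (y ^ 2) ^ M ≤ Real.exp (y ^ 2) * M.factorial := by
    have := Real.pow_div_factorial_le_exp (x := y ^ 2) (by positivity) M
    rwa [div_le_iff₀ hM] at this
  have h2 : 1 ≤ Real.exp (y ^ 2) := Real.one_le_exp (by positivity)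
  have h3 : y ^ M ≤ 1 + (y ^ 2) ^ M := by
    rw [← pow_mul, mul_comm, pow_mul]
    nlinarith [sq_nonneg (y ^ M - 1)]
  rw [Real.exp_neg, ← div_eq_mul_inv, le_div_iff₀ (by positivity), inv_mul_le_iff₀ (by positivity)]
  nlinarith

lemma mellin_gaussian (z : ℂ) {c : ℝ} (hc : 0 < c) (hz : 0 < z.re) :
    ∫ x in Ioi (0 : ℝ), (x : ℂ) ^ (z - 1) * (Real.exp (-(c * x) ^ 2) : ℂ) =
      Gamma (z / 2) / 2 * (c : ℂ) ^ (-z) := by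
  have h1 : mellin (fun x : ℝ => (Real.exp (-(x ^ (2 : ℝ))) : ℂ)) z = Gamma (z / 2) / 2 := by
    rw [mellin_comp_rpow (fun x => (Real.exp (-x) : ℂ)), ← Complex.GammaIntegral_eq_mellin,
      ← Complex.Gamma_eq_integral]
    · norm_num [Complex.real_smul]
      ring
    · norm_num
      exact hz
  have h2 := mellin_comp_mul_left (fun x : ℝ => (Real.exp (-(x ^ (2 : ℝ))) : ℂ)) z hc
  rw [h1, mellin] at h2
  simp only [Real.rpow_two, smul_eq_mul] at h2
  rw [h2, mul_comm]

lemma integrableOn_gaussian (z : ℂ) {c : ℝ} (hc : 0 < c) (hz : 0 < z.re) :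
    IntegrableOn (fun x : ℝ => (x : ℂ) ^ (z - 1) * (Real.exp (-(c * x) ^ 2) : ℂ)) (Ioi 0) := by
  have h := integrableOn_rpow_mul_exp_neg_mul_sq (b := c ^ 2) (by positivity)
    (s := z.re - 1) (by linarith)
  refine Integrable.mono' h ?_ ?_
  · refine ContinuousOn.aestronglyMeasurable ?_ measurableSet_Ioi
    refine ContinuousOn.mul (fun x hx => ?_) (by fun_prop)
    exact (Complex.continuousAt_ofReal_cpow_const x (z - 1)
      (Or.inr (ne_of_gt hx))).continuousWithinAt
  · refine (ae_restrict_iff' measurableSet_Ioi).2 (.of_forall fun x hx => ?_)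
    rw [norm_mul, Complex.norm_cpow_eq_rpow_re_of_pos hx, Complex.norm_real, Real.norm_eq_abs,
      abs_of_pos (Real.exp_pos _)]
    simp [mul_pow]

/-- The incomplete Gaussian Mellin integral agrees with the complete one up to an error that
decays faster than any power of the dilation parameter. -/
lemma exists_norm_integral_gaussian_sub_le (z : ℂ) (hz : 0 < z.re) (M : ℕ) (hM : z.re < M) :
    ∃ C, 0 ≤ C ∧ ∀ c : ℝ, 0 < c →
      ‖(∫ x in (0 : ℝ)..1, (x : ℂ) ^ (z - 1) * (Real.exp (-(c * x) ^ 2) : ℂ)) -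
        Gamma (z / 2) / 2 * (c : ℂ) ^ (-z)‖ ≤ C * (c ^ M)⁻¹ := by
  have hpow : IntegrableOn (fun x : ℝ => x ^ (z.re - 1 - M)) (Ioi 1) :=
    integrableOn_Ioi_rpow_of_lt (by linarith) one_pos
  refine ⟨(1 + M.factorial) * ∫ x in Ioi (1 : ℝ), x ^ (z.re - 1 - M),
    mul_nonneg (by positivity) (setIntegral_nonneg measurableSet_Ioi fun x hx =>
      Real.rpow_nonneg (zero_le_one.trans (le_of_lt hx)) _), fun c hc => ?_⟩
  have hint := integrableOn_gaussian z hc hz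
  have h01 : Ioc (0 : ℝ) 1 ∪ Ioi 1 = Ioi 0 := Ioc_union_Ioi_eq_Ioi zero_le_one
  rw [← mellin_gaussian z hc hz, ← h01, setIntegral_union (by
    rw [disjoint_left]; rintro x ⟨_, h⟩ h'; exact absurd h' (not_lt.2 h)) measurableSet_Ioi
    (hint.mono_set Ioc_subset_Ioi_self) (hint.mono_set (Ioi_subset_Ioi zero_le_one)),
    intervalIntegral.integral_of_le zero_le_one, sub_add_cancel_left, norm_neg]
  rw [mul_right_comm, ← integral_const_mul]
  refine norm_integral_le_of_norm_le (hpow.const_mul _) ?_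
  refine (ae_restrict_iff' measurableSet_Ioi).2 (.of_forall fun x hx => ?_)
  have hx0 : 0 < x := zero_lt_one.trans hx
  rw [norm_mul, Complex.norm_cpow_eq_rpow_re_of_pos hx0, Complex.norm_real, Real.norm_eq_abs,
    abs_of_pos (Real.exp_pos _)]
  have h := exp_neg_sq_le_mul_inv_pow M (mul_pos hc hx0)
  have h2 : x ^ (z.re - 1 - M) = x ^ (z.re - 1) * (x ^ M)⁻¹ := by
    rw [Real.rpow_sub hx0, Real.rpow_natCast, div_eq_mul_inv]
  calc x ^ (z - 1).re * Real.exp (-(c * x) ^ 2)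
      ≤ x ^ (z - 1).re * ((1 + M.factorial) * ((c * x) ^ M)⁻¹) := by gcongr
    _ = _ := by rw [h2, mul_pow, mul_inv]; simp; ring

lemma intervalIntegrable_one_sub_cpow {a : ℂ} (ha : a.re < 1) :
    IntervalIntegrable (fun v : ℝ => (1 - (v : ℂ)) ^ (-a)) volume 0 1 := by
  simpa using Complex.betaIntegral_convergent (u := 1) (v := 1 - a) (by simp) (by simpa using ha)

lemma intervalIntegrable_taylorRem {a : ℂ} (ha : a.re < 1) (L : ℕ) :
    IntervalIntegrable (taylorRem a L) volume 0 1 :=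
  (intervalIntegrable_one_sub_cpow ha).sub
    (Continuous.intervalIntegrable (by fun_prop) _ _)

/-- The Taylor remainder, truncated to `(0, 1]`. -/
noncomputable def taylorRemTrunc (a : ℂ) (L : ℕ) : ℝ → ℂ :=
  (Ioc 0 1).indicator (taylorRem a L)

lemma locallyIntegrableOn_taylorRemTrunc {a : ℂ} (ha : a.re < 1) (L : ℕ) :
    LocallyIntegrableOn (taylorRemTrunc a L) (Ioi 0) := by
  have h := (intervalIntegrable_iff_integrableOn_Ioc_of_le zero_le_one).1
    (intervalIntegrable_taylorRem ha L)
  exact ((integrable_indicator_iff measurableSet_Ioc).2 h).locallyIntegrable.locallyIntegrableOn _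

lemma taylorRemTrunc_isBigO_atTop (a : ℂ) (L : ℕ) :
    taylorRemTrunc a L =O[atTop] fun v : ℝ => Real.exp (-1 * v) := by
  refine EventuallyEq.trans_isBigO (f₂ := fun _ => (0 : ℂ)) ?_ (isBigO_zero _ _)
  filter_upwards [eventually_gt_atTop 1] with v hv
  exact indicator_of_notMem (fun h => absurd h.2 (not_le.2 hv)) _

lemma taylorRemTrunc_isBigO_zero (a : ℂ) (L : ℕ) :
    taylorRemTrunc a L =O[𝓝[>] 0] fun v : ℝ => v ^ (-(-(L : ℝ))) := by
  refine (taylorRem_isBigO a L).congr' ?_ (.of_forall fun v => by simp)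
  filter_upwards [Ioc_mem_nhdsGT (zero_lt_one' ℝ)] with v hv
  exact (indicator_of_mem hv _).symm

lemma mellinConvergent_taylorRemTrunc {a w : ℂ} (ha : a.re < 1) {L : ℕ} (hw : -(L : ℝ) < w.re) :
    MellinConvergent (taylorRemTrunc a L) w :=
  mellinConvergent_of_isBigO_rpow_exp one_pos (locallyIntegrableOn_taylorRemTrunc ha L)
    (taylorRemTrunc_isBigO_atTop a L) (taylorRemTrunc_isBigO_zero a L) hw

lemma differentiableAt_mellin_taylorRemTrunc {a w : ℂ} (ha : a.re < 1) {L : ℕ}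
    (hw : -(L : ℝ) < w.re) : DifferentiableAt ℂ (mellin (taylorRemTrunc a L)) w :=
  mellin_differentiableAt_of_isBigO_rpow_exp one_pos (locallyIntegrableOn_taylorRemTrunc ha L)
    (taylorRemTrunc_isBigO_atTop a L) (taylorRemTrunc_isBigO_zero a L) hw

lemma cpow_smul_taylorRemTrunc (a w : ℂ) (L : ℕ) :
    (fun v : ℝ => (v : ℂ) ^ (w - 1) • taylorRemTrunc a L v) =
      (Ioc 0 1).indicator fun v : ℝ => (v : ℂ) ^ (w - 1) * taylorRem a L v := by
  ext v
  by_cases hv : v ∈ Ioc (0 : ℝ) 1 <;> simp [taylorRemTrunc, hv]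

lemma intervalIntegrable_cpow_mul_taylorRem {a w : ℂ} (ha : a.re < 1) {L : ℕ}
    (hw : -(L : ℝ) < w.re) :
    IntervalIntegrable (fun v : ℝ => (v : ℂ) ^ (w - 1) * taylorRem a L v) volume 0 1 := by
  have h := mellinConvergent_taylorRemTrunc ha hw
  rw [MellinConvergent, cpow_smul_taylorRemTrunc] at h
  rw [intervalIntegrable_iff_integrableOn_Ioc_of_le zero_le_one]
  have h2 := IntegrableOn.mono_set h (Ioc_subset_Ioi_self : Ioc (0 : ℝ) 1 ⊆ Ioi 0)
  exact h2.congr_fun (fun v hv => indicator_of_mem hv _) measurableSet_Ioc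

lemma mellin_taylorRemTrunc (a w : ℂ) (L : ℕ) :
    mellin (taylorRemTrunc a L) w = ∫ v in (0 : ℝ)..1, (v : ℂ) ^ (w - 1) * taylorRem a L v := by
  rw [mellin, cpow_smul_taylorRemTrunc, setIntegral_indicator measurableSet_Ioc,
    intervalIntegral.integral_of_le zero_le_one,
    inter_eq_self_of_subset_right Ioc_subset_Ioi_self]

lemma mellin_taylorRemTrunc_of_re_pos {a w : ℂ} (ha : a.re < 1) (hw : 0 < w.re) (L : ℕ) :
    mellin (taylorRemTrunc a L) w = Gamma w * Gamma (1 - a) / Gamma (w + 1 - a) -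
      ∑ n ∈ Finset.range L, thetaAsc a n / (n.factorial : ℂ) / (w + n) := by
  have hint : ∀ n : ℕ, IntervalIntegrable (fun v : ℝ => (v : ℂ) ^ (w + n - 1)) volume 0 1 :=
    fun n => intervalIntegral.intervalIntegrable_cpow' (by
      simp; linarith [(Nat.cast_nonneg n : (0 : ℝ) ≤ n)])
  have hre : 0 < (1 - a).re := by simpa using ha
  have hB := Complex.Gamma_mul_Gamma_eq_betaIntegral hw hre
  have hG : Gamma (w + (1 - a)) ≠ 0 := Complex.Gamma_ne_zero_of_re_pos (by
    rw [Complex.add_re]; positivity)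
  have hbeta : IntervalIntegrable (fun v : ℝ => (v : ℂ) ^ (w - 1) * (1 - (v : ℂ)) ^ (-a))
      volume 0 1 := by
    simpa using Complex.betaIntegral_convergent hw hre
  have hval : ∀ n : ℕ, ∫ v in (0 : ℝ)..1, (v : ℂ) ^ (w + n - 1) = 1 / (w + n) := fun n => by
    have hpos : 0 < (w + n).re := by simp; positivity
    have hne : w + n ≠ 0 := fun h => by simp [h] at hpos
    rw [integral_cpow (Or.inl (by
      rw [Complex.sub_re, Complex.one_re]; linarith))]
    simp [hne]
  have hcongr : ∫ v in (0 : ℝ)..1, (v : ℂ) ^ (w - 1) * taylorRem a L v =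
      ∫ v in (0 : ℝ)..1, ((v : ℂ) ^ (w - 1) * (1 - (v : ℂ)) ^ (-a) -
        ∑ n ∈ Finset.range L, thetaAsc a n / (n.factorial : ℂ) * (v : ℂ) ^ (w + n - 1)) := by
    refine intervalIntegral.integral_congr_ae (.of_forall fun v hv => ?_)
    rw [uIoc_of_le zero_le_one] at hv
    have hv0 : (v : ℂ) ≠ 0 := by exact_mod_cast hv.1.ne'
    rw [taylorRem, mul_sub, Finset.mul_sum]
    congr 1
    refine Finset.sum_congr rfl fun n _ => ?_
    rw [add_sub_right_comm, Complex.cpow_add _ _ hv0, Complex.cpow_natCast]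
    ring
  have hsum : IntervalIntegrable (fun v : ℝ => ∑ n ∈ Finset.range L,
      thetaAsc a n / (n.factorial : ℂ) * (v : ℂ) ^ (w + n - 1)) volume 0 1 := by
    simpa only [Finset.sum_fn] using
      IntervalIntegrable.sum (Finset.range L) fun n _ => (hint n).const_mul _
  rw [mellin_taylorRemTrunc, hcongr, intervalIntegral.integral_sub hbeta hsum,
    intervalIntegral.integral_finsetSum fun n _ => (hint n).const_mul _]
  congr 1
  · rw [add_sub_assoc, hB, mul_div_cancel_left₀ _ hG, Complex.betaIntegral]
    simp
  · refine Finset.sum_congr rfl fun n _ => ?_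
    rw [intervalIntegral.integral_const_mul, hval, mul_one_div]

lemma Gamma_add_natCast {w : ℂ} (L : ℕ) (hw : ∀ n < L, w + n ≠ 0) :
    Gamma (w + L) = thetaAsc w L * Gamma w := by
  induction L with
  | zero => simp [thetaAsc]
  | succ L ih =>
    rw [Nat.cast_succ, ← add_assoc, Complex.Gamma_add_one _ (hw L L.lt_succ_self),
      ih fun n hn => hw n (hn.trans L.lt_succ_self), thetaAsc, thetaAsc, Finset.prod_range_succ]
    ring

lemma thetaAsc_mul_sum_div {w : ℂ} (L : ℕ) (hw : ∀ n < L, w + n ≠ 0) (g : ℕ → ℂ) :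
    thetaAsc w L * ∑ n ∈ Finset.range L, g n / (w + n) =
      ∑ n ∈ Finset.range L, g n * ∏ m ∈ (Finset.range L).erase n, (w + m) := by
  rw [Finset.mul_sum]
  refine Finset.sum_congr rfl fun n hn => ?_
  rw [thetaAsc, ← Finset.mul_prod_erase _ _ hn]
  field_simp [hw n (Finset.mem_range.1 hn)]

/-- Analytic continuation of Euler's beta integral in its first argument. -/
lemma mellin_taylorRemTrunc_eq {a w : ℂ} (ha : a.re < 1) {L : ℕ} (hw : -(L : ℝ) < w.re)
    (hne : ∀ n < L, w + n ≠ 0) :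
    mellin (taylorRemTrunc a L) w = Gamma w * Gamma (1 - a) / Gamma (w + 1 - a) -
      ∑ n ∈ Finset.range L, thetaAsc a n / (n.factorial : ℂ) / (w + n) := by
  let g : ℕ → ℂ := fun n => thetaAsc a n / (n.factorial : ℂ)
  let F : ℂ → ℂ := fun u => thetaAsc u L * mellin (taylorRemTrunc a L) u +
    ∑ n ∈ Finset.range L, g n * ∏ m ∈ (Finset.range L).erase n, (u + m)
  let G : ℂ → ℂ := fun u => Gamma (u + L) * Gamma (1 - a) * (Gamma (u + 1 - a))⁻¹
  let U : Set ℂ := {u | -(L : ℝ) < u.re}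
  have hU : IsOpen U := isOpen_lt continuous_const Complex.continuous_re
  have hUc : IsPreconnected U := (convex_halfSpace_re_gt _).isPreconnected
  have hF : DifferentiableOn ℂ F U := fun u hu => by
    refine DifferentiableAt.differentiableWithinAt (.add (.mul ?_ ?_) ?_)
    · unfold thetaAsc
      fun_prop
    · exact differentiableAt_mellin_taylorRemTrunc ha hu
    · fun_prop
  have hG : DifferentiableOn ℂ G U := fun u hu => by
    refine DifferentiableAt.differentiableWithinAt (.mul (.mul ?_ (by fun_prop)) ?_)
    · refine DifferentiableAt.comp u (Complex.differentiableAt_Gamma _ fun m hm => ?_)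
        (by fun_prop)
      have := congrArg Complex.re hm
      simp at this
      have hu' : -(L : ℝ) < u.re := hu
      linarith [(Nat.cast_nonneg m : (0 : ℝ) ≤ m)]
    · exact (Complex.differentiable_one_div_Gamma.comp
        (by fun_prop : Differentiable ℂ fun u : ℂ => u + 1 - a)) u
  have key : EqOn F G U := by
    refine (hF.analyticOnNhd hU).eqOn_of_preconnected_of_eventuallyEq (hG.analyticOnNhd hU) hUc
      (z₀ := 1) ?_ ?_
    · simp only [U, mem_ofPred_eq, Complex.one_re]
      linarith [(Nat.cast_nonneg L : (0 : ℝ) ≤ L)]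
    · have : {u : ℂ | 0 < u.re} ∈ 𝓝 (1 : ℂ) :=
        (isOpen_lt continuous_const Complex.continuous_re).mem_nhds (by simp)
      filter_upwards [this] with u hu
      have hu0 : ∀ n < L, u + n ≠ 0 := fun n _ h => by
        have := congrArg Complex.re h
        simp at this
        have hu' : 0 < u.re := hu
        linarith [(Nat.cast_nonneg n : (0 : ℝ) ≤ n)]
      simp only [F, G, g]
      rw [mellin_taylorRemTrunc_of_re_pos ha hu, ← thetaAsc_mul_sum_div L hu0,
        Gamma_add_natCast L hu0]
      ring
  have h := key (show w ∈ U from hw)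
  simp only [F, G, g] at h
  rw [← thetaAsc_mul_sum_div L hne, Gamma_add_natCast L hne] at h
  have h0 : thetaAsc w L ≠ 0 := Finset.prod_ne_zero_iff.2 fun n hn => hne n (Finset.mem_range.1 hn)
  refine mul_left_cancel₀ h0 ?_
  linear_combination h

/-- A double integral of a function of the product `x * v` against powers of `x` and `v`
reduces to two one-dimensional integrals. -/
lemma integral_cpow_mul_integral_comp_mul {f : ℝ → ℂ} (hf : Continuous f) {α : ℂ}
    (hα : 0 < α.re) (n : ℕ) (hne : α - 1 - n ≠ 0) :
    ∫ x in (0 : ℝ)..1, (x : ℂ) ^ (α - 1) * ∫ v in (0 : ℝ)..1, f (x * v) * (v : ℂ) ^ n =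
      ((∫ y in (0 : ℝ)..1, (y : ℂ) ^ n * f y) - ∫ y in (0 : ℝ)..1, (y : ℂ) ^ (α - 1) * f y) /
        (α - 1 - n) := by
  let S : ℝ → ℂ := fun x => ∫ v in (0 : ℝ)..1, f (x * v) * (v : ℂ) ^ n
  let P : ℝ → ℂ := fun x => ∫ y in (0 : ℝ)..x, (y : ℂ) ^ n * f y
  let W : ℝ → ℂ := fun x => ∫ y in (0 : ℝ)..x, (y : ℂ) ^ (α - 1) * f y
  have hS : Continuous S :=
    intervalIntegral.continuous_parametric_intervalIntegral_of_continuous' (by fun_prop) 0 1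
  have hα1 : ∀ b, IntervalIntegrable (fun x : ℝ => (x : ℂ) ^ (α - 1)) volume 0 b := fun b =>
    intervalIntegral.intervalIntegrable_cpow' (by simpa using hα)
  have hWint : ∀ b, IntervalIntegrable (fun y : ℝ => (y : ℂ) ^ (α - 1) * f y) volume 0 b :=
    fun b => (hα1 b).mul_continuousOn hf.continuousOn
  have hSP : ∀ x : ℝ, 0 < x → S x = (x : ℂ) ^ (-(n + 1 : ℂ)) * P x := fun x hx => by
    have hx0 : (x : ℂ) ≠ 0 := by exact_mod_cast hx.ne'
    have h := intervalIntegral.integral_comp_mul_left (fun y : ℝ => (y : ℂ) ^ n * f y)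
      (a := 0) (b := 1) hx.ne'
    simp only [mul_zero, mul_one, Complex.ofReal_mul, mul_pow, Complex.real_smul,
      Complex.ofReal_inv, mul_assoc, intervalIntegral.integral_const_mul] at h
    have h' : (x : ℂ) ^ n * S x = (x : ℂ)⁻¹ * P x := by
      rw [← h]
      simp only [S, mul_comm (f _)]
    rw [Complex.cpow_neg, Complex.cpow_add _ _ hx0, Complex.cpow_natCast, Complex.cpow_one]
    field_simp
    field_simp at h'
    linear_combination h'
  have hcont : Continuous fun x : ℝ => ((x : ℂ) ^ α * S x - W x) / (α - 1 - n) := by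
    refine ((Continuous.mul ?_ hS).sub ?_).div_const _
    · exact Complex.continuous_ofReal_cpow_const hα
    · exact intervalIntegral.continuous_primitive (fun a b =>
        ((hWint a).symm.trans (hWint b))) 0
  have hderiv : ∀ x ∈ Ioo (0 : ℝ) 1, HasDerivAt
      (fun x : ℝ => ((x : ℂ) ^ α * S x - W x) / (α - 1 - n)) ((x : ℂ) ^ (α - 1) * S x) x := by
    intro x hx
    have hx0 : (x : ℂ) ≠ 0 := by exact_mod_cast hx.1.ne'
    have hP : HasDerivAt P ((x : ℂ) ^ n * f x) x :=
      intervalIntegral.integral_hasDerivAt_right (Continuous.intervalIntegrable (by fun_prop) _ _)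
        (Continuous.stronglyMeasurableAtFilter (by fun_prop) _ _) (by fun_prop)
    have hW : HasDerivAt W ((x : ℂ) ^ (α - 1) * f x) x := by
      have hc : ∀ y ∈ Ioi (0 : ℝ), ContinuousAt (fun y : ℝ => (y : ℂ) ^ (α - 1) * f y) y :=
        fun y hy => (Complex.continuousAt_ofReal_cpow_const y _ (Or.inr (ne_of_gt hy))).mul
          hf.continuousAt
      exact intervalIntegral.integral_hasDerivAt_right (hWint x)
        (ContinuousAt.stronglyMeasurableAtFilter isOpen_Ioi hc x hx.1) (hc x hx.1)
    have hpow : HasDerivAt (fun y : ℝ => (y : ℂ) ^ (α - 1 - n))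
        ((α - 1 - n) * (x : ℂ) ^ (α - 1 - n - 1)) x :=
      hasDerivAt_ofReal_cpow_const hx.1.ne' hne
    have h := ((hpow.mul hP).sub hW).div_const (α - 1 - n)
    have heq : (fun y : ℝ => ((y : ℂ) ^ α * S y - W y) / (α - 1 - n)) =ᶠ[𝓝 x]
        fun y : ℝ => ((y : ℂ) ^ (α - 1 - n) * P y - W y) / (α - 1 - n) := by
      filter_upwards [lt_mem_nhds hx.1] with y hy
      have hy0 : (y : ℂ) ≠ 0 := by exact_mod_cast hy.ne'
      rw [hSP y hy, ← mul_assoc, ← Complex.cpow_add _ _ hy0]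
      ring_nf
    refine (h.congr_of_eventuallyEq heq).congr_deriv ?_
    rw [hSP x hx.1, ← mul_assoc ((x : ℂ) ^ (α - 1)), ← Complex.cpow_add _ _ hx0,
      show α - 1 + -(n + 1 : ℂ) = α - 1 - n - 1 by ring]
    have h2 : (x : ℂ) ^ (α - 1) = (x : ℂ) ^ (α - 1 - n) * (x : ℂ) ^ n := by
      rw [← Complex.cpow_natCast, ← Complex.cpow_add _ _ hx0, sub_add_cancel]
    rw [h2]
    field_simp
    ring
  have := intervalIntegral.integral_eq_sub_of_hasDerivAt_of_le zero_le_one hcont.continuousOn hderiv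
    ((hα1 1).mul_continuousOn hS.continuousOn)
  have hα0 : α ≠ 0 := fun h => by simp [h] at hα
  rw [this]
  simp [W, S, Complex.zero_cpow hα0, mul_comm]

lemma integral_cpow_mul_integral_swap {f : ℝ → ℂ} (hf : Continuous f)
    (hf1 : ∀ x, ‖f x‖ ≤ 1) {z : ℂ} (hz : 0 < z.re) {R : ℝ → ℂ}
    (hR : IntervalIntegrable R volume 0 1) :
    ∫ x in (0 : ℝ)..1, (x : ℂ) ^ (z - 1) * ∫ v in (0 : ℝ)..1, f (x * v) * R v =
      ∫ v in (0 : ℝ)..1, R v * ∫ x in (0 : ℝ)..1, (x : ℂ) ^ (z - 1) * f (x * v) := by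
  have hz1 : IntervalIntegrable (fun x : ℝ => (x : ℂ) ^ (z - 1)) volume 0 1 :=
    intervalIntegral.intervalIntegrable_cpow' (by simpa using hz)
  rw [intervalIntegrable_iff_integrableOn_Ioc_of_le zero_le_one] at hz1 hR
  simp only [← intervalIntegral.integral_const_mul]
  rw [intervalIntegral_intervalIntegral_swap]
  · congr! 4
    ring
  · rw [uIoc_of_le zero_le_one, IntegrableOn, Measure.volume_eq_prod, ← Measure.prod_restrict]
    have h := (hz1.mul_prod hR).bdd_mul (f := fun p : ℝ × ℝ => f (p.1 * p.2)) (c := 1)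
      (Continuous.aestronglyMeasurable (by fun_prop)) (.of_forall fun p => hf1 _)
    refine h.congr (.of_forall fun p => ?_)
    simp only [Function.uncurry]
    ring

/-- The contribution of one of the two triangles of the unit square to the heat content, after
the substitution `y = x * (1 - v)`; here `c = 1 / (2 * √t)`. -/
noncomputable def triangleContent (a z : ℂ) (c : ℝ) : ℂ :=
  ∫ x in (0 : ℝ)..1, (x : ℂ) ^ (z - 1) *
    ∫ v in (0 : ℝ)..1, (Real.exp (-(c * (x * v)) ^ 2) : ℂ) * (1 - (v : ℂ)) ^ (-a)

/-- The coefficient of `c ^ (-(n + 1))` in the expansion of `triangleContent a z c`. -/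
noncomputable def triangleCoeff (a z : ℂ) (n : ℕ) : ℂ :=
  thetaAsc a n / (n.factorial : ℂ) * (Gamma ((n + 1) / 2) / 2) / (z - 1 - n)

/-- The coefficient of `c ^ (-z)` in the expansion of `triangleContent a z c`. -/
noncomputable def triangleLeadCoeff (a z : ℂ) : ℂ :=
  Gamma (z / 2) / 2 * (Gamma (1 - z) * Gamma (1 - a) / Gamma (1 - z + 1 - a))

lemma norm_ofReal_exp_neg_sq_le_one (y : ℝ) : ‖(Real.exp (-y ^ 2) : ℂ)‖ ≤ 1 := by
  rw [Complex.norm_real, Real.norm_eq_abs, abs_of_pos (Real.exp_pos _), Real.exp_le_one_iff]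
  nlinarith [sq_nonneg y]

lemma triangleContent_eq {a z : ℂ} (ha : a.re < 1) (hz : 0 < z.re) (L : ℕ)
    (hne : ∀ n < L, z - 1 - n ≠ 0) (c : ℝ) :
    triangleContent a z c =
      ∑ n ∈ Finset.range L, thetaAsc a n / (n.factorial : ℂ) *
        (((∫ y in (0 : ℝ)..1, (y : ℂ) ^ n * (Real.exp (-(c * y) ^ 2) : ℂ)) -
          ∫ y in (0 : ℝ)..1, (y : ℂ) ^ (z - 1) * (Real.exp (-(c * y) ^ 2) : ℂ)) / (z - 1 - n)) +
      ∫ v in (0 : ℝ)..1, taylorRem a L v *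
        ∫ x in (0 : ℝ)..1, (x : ℂ) ^ (z - 1) * (Real.exp (-(c * (x * v)) ^ 2) : ℂ) := by
  let f : ℝ → ℂ := fun y => (Real.exp (-(c * y) ^ 2) : ℂ)
  have hf : Continuous f := by fun_prop
  have hz1 : IntervalIntegrable (fun x : ℝ => (x : ℂ) ^ (z - 1)) volume 0 1 :=
    intervalIntegral.intervalIntegrable_cpow' (by simpa using hz)
  have hSc : ∀ n : ℕ, Continuous fun x : ℝ => ∫ v in (0 : ℝ)..1, f (x * v) * (v : ℂ) ^ n :=
    fun n => intervalIntegral.continuous_parametric_intervalIntegral_of_continuous'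
      (by fun_prop) 0 1
  have hRf : ∀ x : ℝ, IntervalIntegrable (fun v => f (x * v) * taylorRem a L v) volume 0 1 :=
    fun x => (intervalIntegrable_taylorRem ha L).continuousOn_mul (by fun_prop)
  have hsplit : ∀ x : ℝ, ∫ v in (0 : ℝ)..1, f (x * v) * (1 - (v : ℂ)) ^ (-a) =
      (∑ n ∈ Finset.range L, thetaAsc a n / (n.factorial : ℂ) *
        ∫ v in (0 : ℝ)..1, f (x * v) * (v : ℂ) ^ n) +
        ∫ v in (0 : ℝ)..1, f (x * v) * taylorRem a L v := fun x => by
    have h1 : ∀ n : ℕ, IntervalIntegrable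
        (fun v : ℝ => thetaAsc a n / (n.factorial : ℂ) * (f (x * v) * (v : ℂ) ^ n)) volume 0 1 :=
      fun n => Continuous.intervalIntegrable (by fun_prop) _ _
    simp only [← intervalIntegral.integral_const_mul]
    rw [← intervalIntegral.integral_finsetSum fun n _ => h1 n, ← intervalIntegral.integral_add
      (Continuous.intervalIntegrable (by fun_prop) _ _) (hRf x)]
    congr! 2 with v
    simp only [taylorRem, mul_sub, Finset.mul_sum]
    rw [← sub_eq_iff_eq_add']
    congr 1
    exact Finset.sum_congr rfl fun n _ => by ring
  have hRc : IntervalIntegrable (fun x : ℝ => (x : ℂ) ^ (z - 1) *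
      ∫ v in (0 : ℝ)..1, f (x * v) * taylorRem a L v) volume 0 1 := by
    refine hz1.mul_continuousOn (Continuous.continuousOn ?_)
    refine intervalIntegral.continuous_of_dominated_interval
      (bound := fun v => ‖taylorRem a L v‖) (fun x => ?_) (fun x => .of_forall fun v _ => ?_)
      (intervalIntegrable_taylorRem ha L).norm (.of_forall fun v _ => by fun_prop)
    · exact (hRf x).def'.aestronglyMeasurable
    · rw [norm_mul]
      exact mul_le_of_le_one_left (norm_nonneg _) (norm_ofReal_exp_neg_sq_le_one _)
  have hterm : ∀ n : ℕ, IntervalIntegrable (fun x : ℝ => thetaAsc a n / (n.factorial : ℂ) *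
      ((x : ℂ) ^ (z - 1) * ∫ v in (0 : ℝ)..1, f (x * v) * (v : ℂ) ^ n)) volume 0 1 := fun n =>
    (hz1.mul_continuousOn (hSc n).continuousOn).const_mul _
  have hsum : IntervalIntegrable (fun x : ℝ => ∑ n ∈ Finset.range L,
      thetaAsc a n / (n.factorial : ℂ) *
      ((x : ℂ) ^ (z - 1) * ∫ v in (0 : ℝ)..1, f (x * v) * (v : ℂ) ^ n)) volume 0 1 := by
    simpa only [Finset.sum_fn] using IntervalIntegrable.sum (Finset.range L) fun n _ => hterm n
  have hcongr : triangleContent a z c = ∫ x in (0 : ℝ)..1,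
      ((∑ n ∈ Finset.range L, thetaAsc a n / (n.factorial : ℂ) *
        ((x : ℂ) ^ (z - 1) * ∫ v in (0 : ℝ)..1, f (x * v) * (v : ℂ) ^ n)) +
        (x : ℂ) ^ (z - 1) * ∫ v in (0 : ℝ)..1, f (x * v) * taylorRem a L v) := by
    rw [triangleContent]
    congr! 2 with x
    rw [hsplit x, mul_add, Finset.mul_sum]
    congr 1
    exact Finset.sum_congr rfl fun n _ => by ring
  rw [hcongr, intervalIntegral.integral_add hsum hRc,
    intervalIntegral.integral_finsetSum fun n _ => hterm n,
    integral_cpow_mul_integral_swap hf (fun x => norm_ofReal_exp_neg_sq_le_one _) hz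
      (intervalIntegrable_taylorRem ha L)]
  congr 1
  refine Finset.sum_congr rfl fun n hn => ?_
  rw [intervalIntegral.integral_const_mul,
    integral_cpow_mul_integral_comp_mul hf hz n (hne n (Finset.mem_range.1 hn))]

lemma exists_norm_integral_taylorRem_mul_sub_le {a z : ℂ} (ha : a.re < 1) (hz : 0 < z.re) {L : ℕ}
    (hL : z.re < L) :
    ∃ C, 0 ≤ C ∧ ∀ c : ℝ, 0 < c →
      ‖(∫ v in (0 : ℝ)..1, taylorRem a L v *
          ∫ x in (0 : ℝ)..1, (x : ℂ) ^ (z - 1) * (Real.exp (-(c * (x * v)) ^ 2) : ℂ)) -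
        Gamma (z / 2) / 2 * (c : ℂ) ^ (-z) * mellin (taylorRemTrunc a L) (1 - z)‖ ≤
      C * (c ^ L)⁻¹ := by
  obtain ⟨K, hK0, hK⟩ := exists_norm_integral_gaussian_sub_le z hz L hL
  have hI : IntervalIntegrable (fun v : ℝ => ‖(v : ℂ) ^ ((1 - L : ℂ) - 1) * taylorRem a L v‖)
      volume 0 1 := (intervalIntegrable_cpow_mul_taylorRem ha (by simp)).norm
  have hI2 : IntervalIntegrable (fun v : ℝ => (v : ℂ) ^ ((1 - z) - 1) * taylorRem a L v)
      volume 0 1 := intervalIntegrable_cpow_mul_taylorRem ha (by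
        rw [Complex.sub_re, Complex.one_re]; linarith)
  refine ⟨K * ∫ v in (0 : ℝ)..1, ‖(v : ℂ) ^ ((1 - L : ℂ) - 1) * taylorRem a L v‖,
    mul_nonneg hK0 (intervalIntegral.integral_nonneg zero_le_one fun v _ => norm_nonneg _),
    fun c hc => ?_⟩
  let ψ : ℝ → ℂ := fun v =>
    ∫ x in (0 : ℝ)..1, (x : ℂ) ^ (z - 1) * (Real.exp (-(c * (x * v)) ^ 2) : ℂ)
  have hz1 : IntervalIntegrable (fun x : ℝ => (x : ℂ) ^ (z - 1)) volume 0 1 :=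
    intervalIntegral.intervalIntegrable_cpow' (by simpa using hz)
  have hψ : Continuous ψ := by
    refine intervalIntegral.continuous_of_dominated_interval
      (bound := fun x : ℝ => ‖(x : ℂ) ^ (z - 1)‖) (fun v => ?_) (fun v => .of_forall fun x _ => ?_)
      hz1.norm (.of_forall fun x _ => by fun_prop)
    · have hg : Continuous fun x : ℝ => (Real.exp (-(c * (x * v)) ^ 2) : ℂ) := by fun_prop
      exact (hz1.mul_continuousOn hg.continuousOn).def'.aestronglyMeasurable
    · rw [norm_mul]
      exact mul_le_of_le_one_right (norm_nonneg _) (norm_ofReal_exp_neg_sq_le_one _)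
  rw [mellin_taylorRemTrunc, ← intervalIntegral.integral_const_mul,
    ← intervalIntegral.integral_sub
      ((intervalIntegrable_taylorRem ha L).mul_continuousOn hψ.continuousOn) (hI2.const_mul _),
    mul_right_comm, ← intervalIntegral.integral_const_mul]
  refine intervalIntegral.norm_integral_le_of_norm_le zero_le_one (.of_forall fun v hv => ?_)
    (hI.const_mul _)
  have hv0 : 0 < v := hv.1
  have h := hK (c * v) (by positivity)
  have hψv : (∫ x in (0 : ℝ)..1, (x : ℂ) ^ (z - 1) * (Real.exp (-(c * v * x) ^ 2) : ℂ)) = ψ v := by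
    simp only [ψ, mul_assoc, mul_comm v]
  rw [hψv, Complex.ofReal_mul, Complex.mul_cpow_ofReal_nonneg hc.le hv0.le] at h
  have hfac : taylorRem a L v * ψ v -
      Gamma (z / 2) / 2 * (c : ℂ) ^ (-z) * ((v : ℂ) ^ (1 - z - 1) * taylorRem a L v) =
      (ψ v - Gamma (z / 2) / 2 * ((c : ℂ) ^ (-z) * (v : ℂ) ^ (-z))) * taylorRem a L v := by
    rw [show (1 : ℂ) - z - 1 = -z by ring]
    ring
  rw [hfac, norm_mul, norm_mul, Complex.norm_cpow_eq_rpow_re_of_pos hv0,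
    show ((1 - L : ℂ) - 1).re = -(L : ℝ) by simp, Real.rpow_neg hv0.le, Real.rpow_natCast]
  calc _ ≤ K * ((c * v) ^ L)⁻¹ * ‖taylorRem a L v‖ := by gcongr
    _ = _ := by rw [mul_pow, mul_inv]; ring

lemma triangleContent_sub_isBigO_of_lt {a z : ℂ} (ha : a.re < 1) (hz : 0 < z.re) {L : ℕ}
    (hL : z.re < L) (hne : ∀ n < L, z - 1 - n ≠ 0) :
    (fun c : ℝ => triangleContent a z c - triangleLeadCoeff a z * (c : ℂ) ^ (-z) -
      ∑ n ∈ Finset.range L, triangleCoeff a z n * ((c : ℂ) ^ (n + 1))⁻¹)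
      =O[atTop] fun c : ℝ => (c ^ L)⁻¹ := by
  have hgauss : ∀ s : ℂ, 0 < s.re → s.re < (L + 1 : ℕ) →
      (fun c : ℝ => (∫ x in (0 : ℝ)..1, (x : ℂ) ^ (s - 1) * (Real.exp (-(c * x) ^ 2) : ℂ)) -
        Gamma (s / 2) / 2 * (c : ℂ) ^ (-s)) =O[atTop] fun c : ℝ => (c ^ L)⁻¹ := by
    intro s hs hsL
    obtain ⟨K, hK0, hK⟩ := exists_norm_integral_gaussian_sub_le s hs (L + 1) hsL
    refine IsBigO.of_bound K ?_
    filter_upwards [eventually_ge_atTop 1] with c hc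
    have hc0 : 0 < c := by linarith
    refine (hK c hc0).trans (mul_le_mul_of_nonneg_left ?_ hK0)
    rw [Real.norm_of_nonneg (by positivity)]
    exact inv_anti₀ (by positivity) (pow_le_pow_right₀ hc L.le_succ)
  have hrem : (fun c : ℝ => (∫ v in (0 : ℝ)..1, taylorRem a L v *
          ∫ x in (0 : ℝ)..1, (x : ℂ) ^ (z - 1) * (Real.exp (-(c * (x * v)) ^ 2) : ℂ)) -
        Gamma (z / 2) / 2 * (c : ℂ) ^ (-z) * mellin (taylorRemTrunc a L) (1 - z))
        =O[atTop] fun c : ℝ => (c ^ L)⁻¹ := by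
    obtain ⟨K, hK0, hK⟩ := exists_norm_integral_taylorRem_mul_sub_le ha hz hL
    refine IsBigO.of_bound K ?_
    filter_upwards [eventually_gt_atTop 0] with c hc
    rw [Real.norm_of_nonneg (by positivity)]
    exact hK c hc
  have hterm : ∀ n ∈ Finset.range L, (fun c : ℝ =>
      thetaAsc a n / (n.factorial : ℂ) / (z - 1 - n) *
      (((∫ y in (0 : ℝ)..1, (y : ℂ) ^ ((n + 1 : ℂ) - 1) * (Real.exp (-(c * y) ^ 2) : ℂ)) -
        Gamma ((n + 1 : ℂ) / 2) / 2 * (c : ℂ) ^ (-(n + 1 : ℂ))) -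
      ((∫ y in (0 : ℝ)..1, (y : ℂ) ^ (z - 1) * (Real.exp (-(c * y) ^ 2) : ℂ)) -
        Gamma (z / 2) / 2 * (c : ℂ) ^ (-z)))) =O[atTop] fun c : ℝ => (c ^ L)⁻¹ := by
    intro n hn
    have hnL : (n : ℝ) < L := by exact_mod_cast Finset.mem_range.1 hn
    refine ((hgauss _ ?_ ?_).sub (hgauss z hz ?_)).const_mul_left _
    · simp; positivity
    · simpa using hnL
    · push_cast; linarith
  refine ((IsBigO.sum hterm).add hrem).congr_left fun c => ?_
  have hw : -(L : ℝ) < (1 - z).re := by rw [Complex.sub_re, Complex.one_re]; linarith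
  have hne' : ∀ n < L, 1 - z + n ≠ 0 := fun n hn h => hne n hn (by linear_combination -h)
  rw [triangleContent_eq ha hz L hne, mellin_taylorRemTrunc_eq ha hw hne', triangleLeadCoeff]
  have hsum : ∑ n ∈ Finset.range L, (thetaAsc a n / (n.factorial : ℂ) *
        (((∫ y in (0 : ℝ)..1, (y : ℂ) ^ n * (Real.exp (-(c * y) ^ 2) : ℂ)) -
          ∫ y in (0 : ℝ)..1, (y : ℂ) ^ (z - 1) * (Real.exp (-(c * y) ^ 2) : ℂ)) / (z - 1 - n)) -
        triangleCoeff a z n * ((c : ℂ) ^ (n + 1))⁻¹ -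
        Gamma (z / 2) / 2 * (c : ℂ) ^ (-z) * (thetaAsc a n / (n.factorial : ℂ) / (1 - z + n))) =
      ∑ n ∈ Finset.range L, thetaAsc a n / (n.factorial : ℂ) / (z - 1 - n) *
      (((∫ y in (0 : ℝ)..1, (y : ℂ) ^ ((n + 1 : ℂ) - 1) * (Real.exp (-(c * y) ^ 2) : ℂ)) -
        Gamma ((n + 1 : ℂ) / 2) / 2 * (c : ℂ) ^ (-(n + 1 : ℂ))) -
      ((∫ y in (0 : ℝ)..1, (y : ℂ) ^ (z - 1) * (Real.exp (-(c * y) ^ 2) : ℂ)) -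
        Gamma (z / 2) / 2 * (c : ℂ) ^ (-z))) := by
    refine Finset.sum_congr rfl fun n _ => ?_
    have hcp : (c : ℂ) ^ (-(n + 1 : ℂ)) = ((c : ℂ) ^ (n + 1))⁻¹ := by
      rw [Complex.cpow_neg, ← Nat.cast_succ, Complex.cpow_natCast]
    rw [triangleCoeff, hcp, show (1 : ℂ) - z + n = -(z - 1 - n) by ring]
    simp only [add_sub_cancel_right, Complex.cpow_natCast, div_neg]
    ring
  rw [Finset.sum_apply, ← hsum]
  simp only [Finset.sum_sub_distrib, ← Finset.mul_sum]
  ring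

lemma triangleContent_sub_isBigO {a z : ℂ} (ha : a.re < 1) (hz : 0 < z.re)
    (hne : ∀ n : ℕ, z - 1 - n ≠ 0) (N : ℕ) :
    (fun c : ℝ => triangleContent a z c - triangleLeadCoeff a z * (c : ℂ) ^ (-z) -
      ∑ n ∈ Finset.range N, triangleCoeff a z n * ((c : ℂ) ^ (n + 1))⁻¹)
      =O[atTop] fun c : ℝ => (c ^ (N + 1))⁻¹ := by
  obtain ⟨k, hk⟩ := exists_nat_gt z.re
  have hpow : ∀ m, N + 1 ≤ m →
      (fun c : ℝ => (c ^ m)⁻¹) =O[atTop] fun c : ℝ => (c ^ (N + 1))⁻¹ := by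
    intro m hm
    refine IsBigO.of_bound 1 ?_
    filter_upwards [eventually_ge_atTop 1] with c hc
    rw [one_mul, Real.norm_of_nonneg (by positivity), Real.norm_of_nonneg (by positivity)]
    exact inv_anti₀ (by positivity) (pow_le_pow_right₀ hc hm)
  have h := (triangleContent_sub_isBigO_of_lt ha hz (L := N + (k + 1)) (by push_cast; linarith [
    (Nat.cast_nonneg N : (0 : ℝ) ≤ N)]) fun n _ => hne n).trans (hpow _ (by omega))
  have h2 : ∀ i ∈ Finset.range (k + 1), (fun c : ℝ =>
      triangleCoeff a z (N + i) * ((c : ℂ) ^ (N + i + 1))⁻¹)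
      =O[atTop] fun c : ℝ => (c ^ (N + 1))⁻¹ := fun i _ =>
    ((isBigO_of_le _ fun c => by simp).trans (hpow (N + i + 1) (by omega))).const_mul_left _
  refine (h.add (IsBigO.sum h2)).congr_left fun c => ?_
  rw [Finset.sum_range_add, Finset.sum_apply]
  ring

lemma integral_integral_eq_add_triangles {F : ℝ → ℝ → ℂ}
    (hF : Integrable (Function.uncurry F)
      ((volume.restrict (Ioc (0 : ℝ) 1)).prod (volume.restrict (Ioc (0 : ℝ) 1)))) :
    ∫ x in (0 : ℝ)..1, ∫ y in (0 : ℝ)..1, F x y =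
      (∫ x in (0 : ℝ)..1, ∫ y in (0 : ℝ)..x, F x y) +
        ∫ y in (0 : ℝ)..1, ∫ x in (0 : ℝ)..y, F x y := by
  let D : Set (ℝ × ℝ) := {p | p.2 ≤ p.1}
  have hD : MeasurableSet D := measurableSet_le measurable_snd measurable_fst
  have hsplit := integral_add_compl hD hF
  have h1 : ∫ p in D, Function.uncurry F p
      ∂((volume.restrict (Ioc (0 : ℝ) 1)).prod (volume.restrict (Ioc (0 : ℝ) 1))) =
      ∫ x in (0 : ℝ)..1, ∫ y in (0 : ℝ)..x, F x y := by
    rw [← integral_indicator hD, integral_prod _ (hF.indicator hD),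
      intervalIntegral.integral_of_le zero_le_one]
    refine setIntegral_congr_fun measurableSet_Ioc fun x hx => ?_
    have hi : (fun y => D.indicator (Function.uncurry F) (x, y)) =
        (Iic x).indicator fun y => F x y := by
      ext y
      by_cases hy : y ≤ x <;> simp [D, hy]
    simp only [hi]
    rw [setIntegral_indicator measurableSet_Iic, intervalIntegral.integral_of_le hx.1.le,
      Ioc_inter_Iic, min_eq_right hx.2]
  have h2 : ∫ p in Dᶜ, Function.uncurry F p
      ∂((volume.restrict (Ioc (0 : ℝ) 1)).prod (volume.restrict (Ioc (0 : ℝ) 1))) =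
      ∫ y in (0 : ℝ)..1, ∫ x in (0 : ℝ)..y, F x y := by
    rw [← integral_indicator hD.compl, integral_prod_symm _ (hF.indicator hD.compl),
      intervalIntegral.integral_of_le zero_le_one]
    refine setIntegral_congr_fun measurableSet_Ioc fun y hy => ?_
    have hi : (fun x => Dᶜ.indicator (Function.uncurry F) (x, y)) =
        (Iio y).indicator fun x => F x y := by
      ext x
      by_cases hx : x < y <;> simp [D, hx]
    simp only [hi]
    rw [setIntegral_indicator measurableSet_Iio, intervalIntegral.integral_of_le hy.1.le,
      integral_Ioc_eq_integral_Ioo]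
    congr 2
    ext x
    simp only [mem_inter_iff, mem_Ioc, mem_Iio, mem_Ioo]
    exact ⟨fun h => ⟨h.1.1, h.2⟩, fun h => ⟨⟨h.1, h.2.le.trans hy.2⟩, h.2⟩⟩
  rw [← h1, ← h2, hsplit, integral_prod _ hF]
  simp only [intervalIntegral.integral_of_le zero_le_one, Function.uncurry]

lemma integral_gaussian_mul_cpow_mul_cpow (a b : ℂ) (c : ℝ) {x : ℝ} (hx : 0 < x) :
    ∫ y in (0 : ℝ)..x, (Real.exp (-(c * (x - y)) ^ 2) : ℂ) * (x : ℂ) ^ (-a) * (y : ℂ) ^ (-b) =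
      (x : ℂ) ^ (2 - a - b - 1) *
        ∫ v in (0 : ℝ)..1, (Real.exp (-(c * (x * v)) ^ 2) : ℂ) * (1 - (v : ℂ)) ^ (-b) := by
  have hx0 : (x : ℂ) ≠ 0 := by exact_mod_cast hx.ne'
  have h := intervalIntegral.integral_comp_sub_mul (fun y : ℝ =>
    (Real.exp (-(c * (x - y)) ^ 2) : ℂ) * (x : ℂ) ^ (-a) * (y : ℂ) ^ (-b)) (a := 0) (b := 1)
    hx.ne' x
  simp only [mul_one, sub_self, mul_zero, sub_zero, Complex.real_smul, sub_sub_cancel] at h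
  rw [Complex.ofReal_inv, eq_inv_mul_iff_mul_eq₀ hx0] at h
  rw [← h, ← intervalIntegral.integral_const_mul, ← intervalIntegral.integral_const_mul]
  refine intervalIntegral.integral_congr_ae (.of_forall fun v hv => ?_)
  rw [uIoc_of_le zero_le_one] at hv
  have h1 : ((x - x * v : ℝ) : ℂ) ^ (-b) = (x : ℂ) ^ (-b) * (1 - (v : ℂ)) ^ (-b) := by
    rw [show x - x * v = x * (1 - v) by ring, Complex.ofReal_mul,
      Complex.mul_cpow_ofReal_nonneg hx.le (by linarith [hv.2])]
    simp
  have h2 : (x : ℂ) ^ (2 - a - b - 1) = x * (x : ℂ) ^ (-a) * (x : ℂ) ^ (-b) := by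
    rw [show 2 - a - b - 1 = 1 + -a + -b by ring, Complex.cpow_add _ _ hx0,
      Complex.cpow_add _ _ hx0, Complex.cpow_one]
  rw [h1, h2]
  ring

lemma heatContentI_eq_triangleContent {a b : ℂ} (ha : a.re < 1) (hb : b.re < 1) {t : ℝ}
    (ht : 0 < t) :
    heatContentI a b t = (↑(Real.sqrt (4 * Real.pi * t)) : ℂ)⁻¹ *
      (triangleContent a (2 - a - b) (2 * √t)⁻¹ + triangleContent b (2 - a - b) (2 * √t)⁻¹) := by
  have hexp : ∀ x y : ℝ, -(x - y) ^ 2 / (4 * t) = -((2 * √t)⁻¹ * (x - y)) ^ 2 := fun x y => by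
    rw [mul_pow, inv_pow, mul_pow, Real.sq_sqrt ht.le]
    ring
  have hcpow : ∀ {s : ℂ}, s.re < 1 → IntegrableOn (fun x : ℝ => (x : ℂ) ^ (-s)) (Ioc 0 1) :=
    fun hs => (intervalIntegrable_iff_integrableOn_Ioc_of_le zero_le_one).1
      (intervalIntegral.intervalIntegrable_cpow' (by simpa using hs))
  rw [heatContentI]
  simp only [hexp]
  generalize (2 * √t)⁻¹ = c
  congr 1
  rw [integral_integral_eq_add_triangles, add_comm]
  · congr 1
    · refine intervalIntegral.integral_congr_ae (.of_forall fun y hy => ?_)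
      rw [uIoc_of_le zero_le_one] at hy
      rw [sub_right_comm 2 a b, ← integral_gaussian_mul_cpow_mul_cpow b a c hy.1]
      congr! 2 with x
      rw [mul_right_comm, show (c * (x - y)) ^ 2 = (c * (y - x)) ^ 2 by ring]
    · refine intervalIntegral.integral_congr_ae (.of_forall fun x hx => ?_)
      rw [uIoc_of_le zero_le_one] at hx
      exact integral_gaussian_mul_cpow_mul_cpow a b c hx.1
  · have h := (Integrable.mul_prod (hcpow ha) (hcpow hb)).bdd_mul
      (f := fun p : ℝ × ℝ => (Real.exp (-(c * (p.1 - p.2)) ^ 2) : ℂ)) (c := 1)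
      (Continuous.aestronglyMeasurable (by fun_prop))
      (.of_forall fun p => norm_ofReal_exp_neg_sq_le_one _)
    refine h.congr (.of_forall fun p => ?_)
    simp only [Function.uncurry, mul_assoc]

lemma ofReal_cpow_half {t : ℝ} (ht : 0 < t) (s : ℂ) : (t : ℂ) ^ (s / 2) = (√t : ℂ) ^ s := by
  have hr : 0 < √t := Real.sqrt_pos.2 ht
  conv_lhs => rw [← Real.mul_self_sqrt ht.le]
  rw [Complex.ofReal_mul, Complex.mul_cpow_ofReal_nonneg hr.le hr.le,
    ← Complex.cpow_add _ _ (by exact_mod_cast hr.ne'), add_halves]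

lemma sqrt_four_mul_pi_mul (t : ℝ) : √(4 * Real.pi * t) = √Real.pi * (2 * √t) := by
  rw [show 4 * Real.pi * t = Real.pi * (2 ^ 2 * t) by ring, Real.sqrt_mul Real.pi_pos.le,
    Real.sqrt_mul (by positivity), Real.sqrt_sq zero_le_two]

lemma cCoeff_mul_cpow (a b : ℂ) {t : ℝ} (ht : 0 < t) :
    cCoeff a b * (t : ℂ) ^ ((1 - a - b) / 2) = (↑(√(4 * Real.pi * t)) : ℂ)⁻¹ *
      ((triangleLeadCoeff a (2 - a - b) + triangleLeadCoeff b (2 - a - b)) *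
        (((2 * √t)⁻¹ : ℝ) : ℂ) ^ (-(2 - a - b))) := by
  have hr : 0 < √t := Real.sqrt_pos.2 ht
  have hr0 : (√t : ℂ) ≠ 0 := by exact_mod_cast hr.ne'
  have hinv : (((2 * √t)⁻¹ : ℝ) : ℂ) ^ (-(2 - a - b)) = (2 : ℂ) ^ (-a - b) * 2 * 2 *
      ((√t : ℂ) ^ (1 - a - b) * √t) := by
    have harg : ((2 * √t : ℝ) : ℂ).arg ≠ Real.pi := by
      rw [Complex.arg_ofReal_of_nonneg (by positivity)]
      exact Real.pi_pos.ne
    rw [Complex.ofReal_inv, Complex.inv_cpow _ _ harg, ← Complex.cpow_neg, neg_neg,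
      Complex.ofReal_mul, Complex.mul_cpow_ofReal_nonneg zero_le_two hr.le, Complex.ofReal_ofNat,
      show (2 - a - b) = (1 - a - b) + 1 by ring, Complex.cpow_add _ _ hr0, Complex.cpow_one,
      show (1 - a - b) + 1 = (-a - b) + 1 + 1 by ring, Complex.cpow_add _ _ two_ne_zero,
      Complex.cpow_add _ _ two_ne_zero, Complex.cpow_one]
  have h1 : 1 - (2 - a - b) + 1 - a = b := by ring
  have h2 : 1 - (2 - a - b) + 1 - b = a := by ring
  have h3 : 1 - (2 - a - b) = a + b - 1 := by ring
  rw [ofReal_cpow_half ht, hinv, sqrt_four_mul_pi_mul, triangleLeadCoeff, triangleLeadCoeff, h1, h2,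
    h3, cCoeff]
  push_cast
  field_simp

lemma cnCoeff_mul_cpow (a b : ℂ) {t : ℝ} (ht : 0 < t) (n : ℕ) :
    cnCoeff a b n * (t : ℂ) ^ ((n : ℂ) / 2) = (↑(√(4 * Real.pi * t)) : ℂ)⁻¹ *
      ((triangleCoeff a (2 - a - b) n + triangleCoeff b (2 - a - b) n) *
        ((((2 * √t)⁻¹ : ℝ) : ℂ) ^ (n + 1))⁻¹) := by
  have hr : 0 < √t := Real.sqrt_pos.2 ht
  have hr0 : (√t : ℂ) ≠ 0 := by exact_mod_cast hr.ne'
  have hz : 2 - a - b - 1 - n = 1 - a - b - n := by ring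
  rw [ofReal_cpow_half ht, Complex.cpow_natCast, sqrt_four_mul_pi_mul, triangleCoeff,
    triangleCoeff, hz, cnCoeff, zpow_sub₀ two_ne_zero, zpow_natCast, zpow_one, add_comm (n : ℂ) 1]
  push_cast
  rw [inv_pow, inv_inv, mul_pow, pow_succ, pow_succ]
  simp only [div_eq_mul_inv, mul_inv]
  field_simp

/-- Theorem 3.1: the complete asymptotic expansion of `h_{a,b}(t)` as `t ↓ 0` when
`a + b` avoids the integers `n ≤ 1`. -/
theorem heatContentI_asymptotic_expansion
    (a b : ℂ) (ha : a.re < 1) (hb : b.re < 1)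
    (hab : ∀ n : ℤ, n ≤ 1 → a + b ≠ (n : ℂ)) (N : ℕ) :
    ∃ C > 0, ∃ t₀ > 0, ∀ t : ℝ, 0 < t → t < t₀ →
      ‖heatContentI a b t - cCoeff a b * (t : ℂ) ^ ((1 - a - b) / 2)
          - ∑ n ∈ Finset.range (N + 1), cnCoeff a b n * (t : ℂ) ^ ((n : ℂ) / 2)‖
        ≤ C * t ^ ((N + 1 : ℝ) / 2) := by
  obtain ⟨K, hK0, hK⟩ := ((triangleContent_sub_isBigO ha (z := 2 - a - b) (by simp; linarith)
    (fun n h => hab (1 - n) (by omega) (by push_cast; linear_combination -h)) (N + 1)).add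
    (triangleContent_sub_isBigO hb (z := 2 - a - b) (by simp; linarith)
    (fun n h => hab (1 - n) (by omega) (by push_cast; linear_combination -h))
    (N + 1))).exists_pos
  obtain ⟨m, hm⟩ := eventually_atTop.1 hK.bound
  refine ⟨(√Real.pi)⁻¹ * K * 2 ^ (N + 1), by positivity, (2 * max m 1)⁻¹ ^ 2, by positivity,
    fun t ht ht0 => ?_⟩
  have hr : 0 < √t := Real.sqrt_pos.2 ht
  have hrm : m ≤ (2 * √t)⁻¹ := by
    have h1 : √t < (2 * max m 1)⁻¹ := (Real.sqrt_lt' (by positivity)).2 ht0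
    rw [lt_inv_comm₀ hr (by positivity)] at h1
    rw [mul_inv]
    linarith [le_max_left m 1]
  have hbound := hm _ hrm
  have hsub : heatContentI a b t - cCoeff a b * (t : ℂ) ^ ((1 - a - b) / 2)
      - ∑ n ∈ Finset.range (N + 1), cnCoeff a b n * (t : ℂ) ^ ((n : ℂ) / 2) =
      (↑(√(4 * Real.pi * t)) : ℂ)⁻¹ *
        (triangleContent a (2 - a - b) (2 * √t)⁻¹ -
            triangleLeadCoeff a (2 - a - b) * (((2 * √t)⁻¹ : ℝ) : ℂ) ^ (-(2 - a - b)) -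
            ∑ n ∈ Finset.range (N + 1),
              triangleCoeff a (2 - a - b) n * ((((2 * √t)⁻¹ : ℝ) : ℂ) ^ (n + 1))⁻¹ +
          (triangleContent b (2 - a - b) (2 * √t)⁻¹ -
            triangleLeadCoeff b (2 - a - b) * (((2 * √t)⁻¹ : ℝ) : ℂ) ^ (-(2 - a - b)) -
            ∑ n ∈ Finset.range (N + 1),
              triangleCoeff b (2 - a - b) n * ((((2 * √t)⁻¹ : ℝ) : ℂ) ^ (n + 1))⁻¹)) := by
    rw [heatContentI_eq_triangleContent ha hb ht, cCoeff_mul_cpow a b ht,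
      Finset.sum_congr rfl fun n _ => cnCoeff_mul_cpow a b ht n, ← Finset.mul_sum]
    simp only [add_mul, Finset.sum_add_distrib]
    ring
  have hpow : t ^ ((N + 1 : ℝ) / 2) = √t ^ (N + 1) := by
    rw [Real.sqrt_eq_rpow, ← Real.rpow_natCast, ← Real.rpow_mul ht.le]
    push_cast
    ring_nf
  rw [hsub, norm_mul, norm_inv, Complex.norm_real, Real.norm_of_nonneg (Real.sqrt_nonneg _),
    sqrt_four_mul_pi_mul, hpow]
  rw [Real.norm_of_nonneg (by positivity), inv_pow, inv_inv] at hbound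
  refine (mul_le_mul_of_nonneg_left hbound (by positivity)).trans_eq ?_
  have hpi : 0 < √Real.pi := Real.sqrt_pos.2 Real.pi_pos
  field_simp
  ring
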